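/- Random variables X_1,…,X_n with E|X_j|^α < ∞ whose joint distribution possesses the canonical representation with kernels g satisfying A1–A3 form a multiplicative system of order α if and only if E[ ξ_{i_1}^{α_{i_1}} ⋯ ξ_{i_c}^{α_{i_c}} g_{i_1,…,i_c}(ξ_{i_1},…,ξ_{i_c}) ] = 0 for all 1 ≤ i_1 < ⋯ < i_c ≤ n, c = 2,…,n, and all exponents α_j ∈ {0,1,…,α}. -/

import Mathlib

open MeasureTheory Finset

/-- A function `g` on `ℝⁿ` depends only on the coordinates in `S`
(i.e., it is really a function of the variables `x_i`, `i ∈ S`). -/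
def DependsOnlyOn {n : ℕ} (S : Finset (Fin n)) (g : (Fin n → ℝ) → ℝ) : Prop :=
  ∀ x y : Fin n → ℝ, (∀ i ∈ S, x i = y i) → g x = g y

/-- The sum of U-statistics `U_n(x) = Σ_{c=2}^n Σ_{i_1<⋯<i_c} g_{i_1,…,i_c}(x_{i_1},…,x_{i_c})`,
where the kernel for the index set `S = {i_1,…,i_c}` is `g S`. -/
noncomputable def Usum {n : ℕ} (g : Finset (Fin n) → (Fin n → ℝ) → ℝ) (x : Fin n → ℝ) : ℝ :=
  ∑ S ∈ Finset.univ.filter (fun S : Finset (Fin n) => 2 ≤ S.card), g S x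

/-- Conditions A1 (integrability), A2 (degeneracy: zero mean in each argument, a.s. in
the remaining arguments) and A3 (positive definiteness: `U_n ≥ -1` a.s.) for a family of
Borel kernels `g_{i_1,…,i_c}`, with respect to independent random variables `ξ_1,…,ξ_n`
with distributions `μ_1,…,μ_n` (whose joint law is `Measure.pi μ`). -/
def IsKernelSystem {n : ℕ} (μ : Fin n → Measure ℝ) (g : Finset (Fin n) → (Fin n → ℝ) → ℝ) :
    Prop :=
  (∀ S : Finset (Fin n), 2 ≤ S.card →
      Measurable (g S) ∧ DependsOnlyOn S (g S) ∧
      Integrable (g S) (Measure.pi μ) ∧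
      ∀ k ∈ S, ∀ᵐ x ∂Measure.pi μ, ∫ t, g S (Function.update x k t) ∂μ k = 0) ∧
  (∀ᵐ x ∂Measure.pi μ, -1 ≤ Usum g x)

section ProductMeasure

variable {n : ℕ} (μ : Fin n → Measure ℝ) [∀ i, IsProbabilityMeasure (μ i)]

/-- Gluing the coordinates in `S` of one sample of a product law to the remaining coordinates of
an independent sample yields the same product law. -/
lemma measurePreserving_piecewise (S : Finset (Fin n)) :
    MeasurePreserving (fun p : (Fin n → ℝ) × (Fin n → ℝ) => S.piecewise p.1 p.2)
      ((Measure.pi μ).prod (Measure.pi μ)) (Measure.pi μ) := by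
  have hm : Measurable (fun p : (Fin n → ℝ) × (Fin n → ℝ) => S.piecewise p.1 p.2) := by
    refine measurable_pi_lambda _ fun i => ?_
    by_cases hi : i ∈ S <;> simp only [Finset.piecewise, hi, if_true, if_false] <;> fun_prop
  refine ⟨hm, (Measure.pi_eq fun s hs => ?_).symm⟩
  rw [Measure.map_apply hm (MeasurableSet.univ_pi hs)]
  have : (fun p : (Fin n → ℝ) × (Fin n → ℝ) => S.piecewise p.1 p.2) ⁻¹' (Set.univ.pi s) =
      (Set.univ.pi fun i => if i ∈ S then s i else Set.univ) ×ˢ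
        (Set.univ.pi fun i => if i ∈ S then Set.univ else s i) := by
    ext p
    simp only [Set.mem_preimage, Set.mem_pi, Set.mem_univ, true_imp_iff, Set.mem_prod,
      ← forall_and]
    refine forall_congr' fun i => ?_
    by_cases hi : i ∈ S <;> simp [hi]
  rw [this, Measure.prod_prod, Measure.pi_pi, Measure.pi_pi, ← Finset.prod_mul_distrib]
  refine Finset.prod_congr rfl fun i _ => ?_
  by_cases hi : i ∈ S <;> simp [hi]

/-- Resampling one coordinate of a product law independently preserves the law. -/
lemma measurePreserving_update (k : Fin n) :
    MeasurePreserving (fun p : (Fin n → ℝ) × ℝ => Function.update p.1 k p.2)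
      ((Measure.pi μ).prod (μ k)) (Measure.pi μ) := by
  have hm : Measurable (fun p : (Fin n → ℝ) × ℝ => Function.update p.1 k p.2) := by
    refine measurable_pi_lambda _ fun i => ?_
    by_cases hi : i = k
    · subst hi; simpa using measurable_snd
    · simp only [Function.update_of_ne hi]; fun_prop
  refine ⟨hm, (Measure.pi_eq fun s hs => ?_).symm⟩
  rw [Measure.map_apply hm (MeasurableSet.univ_pi hs)]
  have : (fun p : (Fin n → ℝ) × ℝ => Function.update p.1 k p.2) ⁻¹' (Set.univ.pi s) =
      (Set.univ.pi fun i => if i = k then Set.univ else s i) ×ˢ s k := by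
    ext p
    simp only [Set.mem_preimage, Set.mem_pi, Set.mem_univ, true_imp_iff, Set.mem_prod]
    constructor
    · refine fun h => ⟨fun i => ?_, by simpa using h k⟩
      by_cases hi : i = k
      · simp [hi]
      · simpa [hi] using h i
    · rintro ⟨h, hk⟩ i
      by_cases hi : i = k
      · subst hi; simpa using hk
      · simpa [hi] using h i
  rw [this, Measure.prod_prod, Measure.pi_pi, ← Finset.mul_prod_erase _ _ (Finset.mem_univ k),
    ← Finset.mul_prod_erase _ (fun i => μ i (s i)) (Finset.mem_univ k)]
  simp only [if_true, measure_univ, one_mul]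
  rw [mul_comm]
  congr 1
  refine Finset.prod_congr rfl fun i hi => ?_
  rw [if_neg (Finset.ne_of_mem_erase hi)]

variable {μ}

lemma comp_piecewise_eq_mul {S : Finset (Fin n)} {F G : (Fin n → ℝ) → ℝ}
    (hF : DependsOnlyOn S F) (hG : DependsOnlyOn Sᶜ G) :
    (fun x => F x * G x) ∘ (fun p : (Fin n → ℝ) × (Fin n → ℝ) => S.piecewise p.1 p.2) =
      fun p => F p.1 * G p.2 := by
  funext p
  have h₁ : F (S.piecewise p.1 p.2) = F p.1 := hF _ _ fun i hi => by simp [hi]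
  have h₂ : G (S.piecewise p.1 p.2) = G p.2 :=
    hG _ _ fun i hi => by simp [Finset.mem_compl.1 hi]
  simp [h₁, h₂]

lemma integrable_mul_of_dependsOnlyOn {S : Finset (Fin n)} {F G : (Fin n → ℝ) → ℝ}
    (hF : DependsOnlyOn S F) (hG : DependsOnlyOn Sᶜ G)
    (hFi : Integrable F (Measure.pi μ)) (hGi : Integrable G (Measure.pi μ)) :
    Integrable (fun x => F x * G x) (Measure.pi μ) := by
  refine ((measurePreserving_piecewise μ S).integrable_comp
    (hFi.aestronglyMeasurable.mul hGi.aestronglyMeasurable)).1 ?_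
  refine Eq.mpr (congrArg (fun f => Integrable f _) (comp_piecewise_eq_mul hF hG)) ?_
  exact hFi.mul_prod hGi

lemma integral_mul_of_dependsOnlyOn {S : Finset (Fin n)} {F G : (Fin n → ℝ) → ℝ}
    (hF : DependsOnlyOn S F) (hG : DependsOnlyOn Sᶜ G)
    (hFi : Integrable F (Measure.pi μ)) (hGi : Integrable G (Measure.pi μ)) :
    ∫ x, F x * G x ∂Measure.pi μ = (∫ x, F x ∂Measure.pi μ) * ∫ x, G x ∂Measure.pi μ := by
  have hmp := measurePreserving_piecewise μ S
  have hm := (integrable_mul_of_dependsOnlyOn hF hG hFi hGi).aestronglyMeasurable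
  rw [← hmp.map_eq] at hm
  have h := integral_map hmp.measurable.aemeasurable hm
  rw [hmp.map_eq] at h
  rw [h, ← integral_prod_mul]
  exact congrArg (fun f => ∫ p, f p ∂(Measure.pi μ).prod (Measure.pi μ))
    (comp_piecewise_eq_mul hF hG)

/-- A function whose mean in one coordinate vanishes almost surely has mean zero. -/
lemma integral_eq_zero_of_ae_integral_update {F : (Fin n → ℝ) → ℝ} (k : Fin n)
    (hFi : Integrable F (Measure.pi μ))
    (hF : ∀ᵐ x ∂Measure.pi μ, ∫ t, F (Function.update x k t) ∂μ k = 0) :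
    ∫ x, F x ∂Measure.pi μ = 0 := by
  have hmp := measurePreserving_update μ k
  have hi := (hmp.integrable_comp hFi.aestronglyMeasurable).2 hFi
  have hm := hFi.aestronglyMeasurable
  rw [← hmp.map_eq] at hm
  have h := integral_map hmp.measurable.aemeasurable hm
  rw [hmp.map_eq] at h
  refine h.trans ((integral_prod _ hi).trans ?_)
  exact integral_eq_zero_of_ae hF

lemma integrable_pow_of_le {ρ : Measure ℝ} [IsProbabilityMeasure ρ] {α b : ℕ} (hb : b ≤ α)
    (h : Integrable (fun t : ℝ => |t| ^ α) ρ) : Integrable (fun t : ℝ => t ^ b) ρ := by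
  refine ((integrable_const (1 : ℝ)).add h).mono' (by fun_prop) (ae_of_all _ fun t => ?_)
  simp only [Pi.add_apply, norm_pow, Real.norm_eq_abs]
  rcases le_total |t| 1 with ht | ht
  · have := pow_le_one₀ (n := b) (abs_nonneg t) ht
    have := pow_nonneg (abs_nonneg t) α
    linarith
  · have := pow_le_pow_right₀ ht hb
    linarith

lemma integrable_prod_pow {α : ℕ} (hmom : ∀ j, Integrable (fun t : ℝ => |t| ^ α) (μ j))
    {a : Fin n → ℕ} (ha : ∀ j, a j ≤ α) :
    Integrable (fun x : Fin n → ℝ => ∏ j, x j ^ a j) (Measure.pi μ) :=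
  Integrable.fintype_prod (f := fun j (t : ℝ) => t ^ a j)
    fun j => integrable_pow_of_le (ha j) (hmom j)

end ProductMeasure

lemma IsKernelSystem.measurable_Usum {n : ℕ} {μ : Fin n → Measure ℝ}
    {g : Finset (Fin n) → (Fin n → ℝ) → ℝ} (hg : IsKernelSystem μ g) : Measurable (Usum g) :=
  Finset.measurable_sum _ fun S hS => (hg.1 S (Finset.mem_filter.1 hS).2).1

section Kernels

variable {n α : ℕ} {μ : Fin n → Measure ℝ} [∀ i, IsProbabilityMeasure (μ i)]
  {g : Finset (Fin n) → (Fin n → ℝ) → ℝ}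

lemma prod_pow_mul_eq (S : Finset (Fin n)) (a : Fin n → ℕ) (x : Fin n → ℝ) (c : ℝ) :
    (∏ j, x j ^ a j) * c =
      ((∏ i ∈ S, x i ^ a i) * c) * ∏ j, x j ^ (if j ∈ S then 0 else a j) := by
  have : ∏ j, x j ^ (if j ∈ S then 0 else a j) = ∏ j ∈ Sᶜ, x j ^ a j := by
    rw [← Finset.prod_mul_prod_compl S, Finset.prod_eq_one fun i hi => by simp [hi], one_mul]
    exact Finset.prod_congr rfl fun i hi => by rw [if_neg (Finset.mem_compl.1 hi)]
  rw [this, ← Finset.prod_mul_prod_compl S]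
  ring

lemma DependsOnlyOn.prod_pow_mul {S : Finset (Fin n)} {G : (Fin n → ℝ) → ℝ}
    (hG : DependsOnlyOn S G) (a : Fin n → ℕ) :
    DependsOnlyOn S fun x => (∏ i ∈ S, x i ^ a i) * G x := fun x y hxy => by
  have h : ∏ i ∈ S, x i ^ a i = ∏ i ∈ S, y i ^ a i :=
    Finset.prod_congr rfl fun i hi => by rw [hxy i hi]
  simp only [hG x y hxy, h]

lemma dependsOnlyOn_compl_prod_pow (S : Finset (Fin n)) (a : Fin n → ℕ) :
    DependsOnlyOn Sᶜ fun x => ∏ j, x j ^ (if j ∈ S then 0 else a j) := fun x y hxy =>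
  Finset.prod_congr rfl fun i _ => by
    by_cases hi : i ∈ S
    · simp [hi]
    · rw [hxy i (Finset.mem_compl.2 hi)]

lemma integrable_prod_pow_mul_kernel {S : Finset (Fin n)} {G : (Fin n → ℝ) → ℝ}
    (hG : DependsOnlyOn S G)
    (hmom : ∀ j, Integrable (fun t : ℝ => |t| ^ α) (μ j)) {a : Fin n → ℕ} (ha : ∀ j, a j ≤ α)
    (hi : Integrable (fun x : Fin n → ℝ => (∏ i ∈ S, x i ^ a i) * G x) (Measure.pi μ)) :
    Integrable (fun x : Fin n → ℝ => (∏ j, x j ^ a j) * G x) (Measure.pi μ) := by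
  simp only [prod_pow_mul_eq S]
  refine integrable_mul_of_dependsOnlyOn (hG.prod_pow_mul a)
    (dependsOnlyOn_compl_prod_pow S a) hi (integrable_prod_pow hmom fun j => ?_)
  split_ifs
  exacts [Nat.zero_le _, ha j]

lemma integral_prod_pow_mul_kernel_eq_zero {S : Finset (Fin n)} {G : (Fin n → ℝ) → ℝ}
    (hG : DependsOnlyOn S G)
    (hmom : ∀ j, Integrable (fun t : ℝ => |t| ^ α) (μ j)) {a : Fin n → ℕ} (ha : ∀ j, a j ≤ α)
    (hi : Integrable (fun x : Fin n → ℝ => (∏ i ∈ S, x i ^ a i) * G x) (Measure.pi μ))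
    (h0 : ∫ x, (∏ i ∈ S, x i ^ a i) * G x ∂Measure.pi μ = 0) :
    ∫ x, (∏ j, x j ^ a j) * G x ∂Measure.pi μ = 0 := by
  simp only [prod_pow_mul_eq S]
  rw [integral_mul_of_dependsOnlyOn (hG.prod_pow_mul a)
    (dependsOnlyOn_compl_prod_pow S a) hi (integrable_prod_pow hmom fun j => ?_), h0, zero_mul]
  split_ifs
  exacts [Nat.zero_le _, ha j]

/-- Mixed moments of a law with a canonical representation. -/
lemma IsKernelSystem.integral_prod_pow_withDensity (hg : IsKernelSystem μ g)
    (hmom : ∀ j, Integrable (fun t : ℝ => |t| ^ α) (μ j))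
    (hintξ : ∀ S : Finset (Fin n), 2 ≤ S.card → ∀ a : Fin n → ℕ, (∀ j, a j ≤ α) →
      Integrable (fun x : Fin n → ℝ => (∏ i ∈ S, x i ^ a i) * g S x) (Measure.pi μ))
    {a : Fin n → ℕ} (ha : ∀ j, a j ≤ α) :
    ∫ x, ∏ j, x j ^ a j ∂(Measure.pi μ).withDensity
        (fun x => ENNReal.ofReal (1 + Usum g x)) =
      ∏ j, ∫ t, t ^ a j ∂μ j +
        ∑ S ∈ Finset.univ.filter (fun S : Finset (Fin n) => 2 ≤ S.card),
          ∫ x, (∏ j, x j ^ a j) * g S x ∂Measure.pi μ := by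
  have hi : ∀ S ∈ Finset.univ.filter (fun S : Finset (Fin n) => 2 ≤ S.card),
      Integrable (fun x : Fin n → ℝ => (∏ j, x j ^ a j) * g S x) (Measure.pi μ) := fun S hS => by
    have hS := (Finset.mem_filter.1 hS).2
    exact integrable_prod_pow_mul_kernel (hg.1 S hS).2.1 hmom ha (hintξ S hS a ha)
  have hm : Measurable fun x => ENNReal.ofReal (1 + Usum g x) :=
    (hg.measurable_Usum.const_add 1).ennreal_ofReal
  rw [integral_withDensity_eq_integral_toReal_smul hm
    (ae_of_all _ fun _ => ENNReal.ofReal_lt_top), ← integral_finsetSum _ hi,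
    ← integral_fintype_prod_eq_prod (fun j (t : ℝ) => t ^ a j),
    ← integral_add (integrable_prod_pow hmom ha) (integrable_finsetSum _ hi)]
  refine integral_congr_ae ?_
  filter_upwards [hg.2] with x hx
  rw [ENNReal.toReal_ofReal (by linarith), ← Finset.mul_sum, smul_eq_mul, Usum]
  ring

/-- A degenerate kernel is orthogonal to monomials not involving one of its variables. -/
lemma IsKernelSystem.integral_prod_pow_mul_eq_zero (hg : IsKernelSystem μ g)
    {S : Finset (Fin n)} (hS : 2 ≤ S.card) {a : Fin n → ℕ} {k : Fin n} (hk : k ∈ S)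
    (hak : a k = 0)
    (hi : Integrable (fun x : Fin n → ℝ => (∏ j, x j ^ a j) * g S x) (Measure.pi μ)) :
    ∫ x, (∏ j, x j ^ a j) * g S x ∂Measure.pi μ = 0 := by
  refine integral_eq_zero_of_ae_integral_update k hi ?_
  filter_upwards [(hg.1 S hS).2.2.2 k hk] with x hx
  have : ∀ t, ∏ j, Function.update x k t j ^ a j = ∏ j, x j ^ a j := fun t =>
    Finset.prod_congr rfl fun j _ => by
      by_cases hj : j = k
      · subst hj; simp [hak]
      · rw [Function.update_of_ne hj]
  simp only [this, integral_const_mul, hx, mul_zero]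

end Kernels

/-- Theorem 5.7: random variables `X₁,…,Xₙ` with `E|X_j|^α < ∞` whose joint law `ν` has the
canonical representation with kernels `g` satisfying A1–A3 form a multiplicative system of
order `α` (i.e. `E ∏ X_j^{α_j} = ∏ E X_j^{α_j}` for all exponents `α_j ∈ {0,1,…,α}`) if and
only if `E[ξ_{i₁}^{α_{i₁}} ⋯ ξ_{i_c}^{α_{i_c}} g_{i₁,…,i_c}(ξ_{i₁},…,ξ_{i_c})] = 0` for all
`i₁ < ⋯ < i_c` and all exponents `α_j ∈ {0,1,…,α}`. -/
theorem statement10 (n : ℕ) (α : ℕ)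
    (μ : Fin n → Measure ℝ) [∀ i, IsProbabilityMeasure (μ i)]
    (g : Finset (Fin n) → (Fin n → ℝ) → ℝ) (hg : IsKernelSystem μ g)
    (ν : Measure (Fin n → ℝ))
    (hrep : ν = (Measure.pi μ).withDensity fun x => ENNReal.ofReal (1 + Usum g x))
    (hmom : ∀ j, Integrable (fun t : ℝ => |t| ^ α) (μ j))
    (hintX : ∀ a : Fin n → ℕ, (∀ j, a j ≤ α) →
      Integrable (fun x : Fin n → ℝ => ∏ j, x j ^ a j) ν)
    (hintξ : ∀ S : Finset (Fin n), 2 ≤ S.card → ∀ a : Fin n → ℕ, (∀ j, a j ≤ α) →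
      Integrable (fun x : Fin n → ℝ => (∏ i ∈ S, x i ^ a i) * g S x) (Measure.pi μ)) :
    (∀ a : Fin n → ℕ, (∀ j, a j ≤ α) →
        ∫ x, ∏ j, x j ^ a j ∂ν = ∏ j, ∫ t, t ^ a j ∂μ j) ↔
      (∀ S : Finset (Fin n), 2 ≤ S.card → ∀ a : Fin n → ℕ, (∀ j, a j ≤ α) →
        ∫ x, (∏ i ∈ S, x i ^ a i) * g S x ∂Measure.pi μ = 0) := by
  subst hrep
  constructor
  · intro h S
    induction S using Finset.strongInduction with
    | H S ih =>
      intro hS a ha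
      set b : Fin n → ℕ := fun j => if j ∈ S then a j else 0 with hb
      have hbα : ∀ j, b j ≤ α := fun j => by
        simp only [hb]
        split_ifs
        exacts [ha j, Nat.zero_le _]
      have key := h b hbα
      rw [hg.integral_prod_pow_withDensity hmom hintξ hbα, add_eq_left,
        Finset.sum_eq_single S] at key
      · have hprod : ∀ x : Fin n → ℝ, ∏ j, x j ^ b j = ∏ i ∈ S, x i ^ a i := fun x => by
          simp [hb, pow_ite, Finset.prod_ite_mem]
        simpa only [hprod] using key
      · intro T hT hTS
        have hT := (Finset.mem_filter.1 hT).2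
        have hdep := (hg.1 T hT).2.1
        by_cases hsub : T ⊆ S
        · exact integral_prod_pow_mul_kernel_eq_zero hdep hmom hbα (hintξ T hT b hbα)
            (ih T (hsub.ssubset_of_ne hTS) hT b hbα)
        · obtain ⟨k, hkT, hkS⟩ := Finset.not_subset.1 hsub
          exact hg.integral_prod_pow_mul_eq_zero hT hkT (by simp [hb, hkS])
            (integrable_prod_pow_mul_kernel hdep hmom hbα (hintξ T hT b hbα))
      · simp [hS]
  · intro h a ha
    rw [hg.integral_prod_pow_withDensity hmom hintξ ha, Finset.sum_eq_zero, add_zero]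
    intro S hS
    have hS := (Finset.mem_filter.1 hS).2
    exact integral_prod_pow_mul_kernel_eq_zero (hg.1 S hS).2.1 hmom ha (hintξ S hS a ha)
      (h S hS a ha)
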